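/- Suppose j ≥ 3 and α = α_1⋯α_j and β = β_1⋯β_j are minimal overlapping permutations in S_j with α_1 = β_1, α_j = β_j, and inv(α) = inv(β). Then for all n ≥ 0, Σ_{σ∈S_n} x^{α-mch(σ)} q^{inv(σ)} = Σ_{σ∈S_n} x^{β-mch(σ)} q^{inv(σ)}, as polynomials in x and q (i.e. α and β are strongly inv-c-Wilf equivalent). -/

import Mathlib

open scoped Classical

noncomputable section

namespace CWilf

/-- The number of descents of a permutation of `{0, …, n-1}` (0-based). -/
def des {n : ℕ} (σ : Equiv.Perm (Fin n)) : ℕ :=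
  (Finset.univ.filter fun i : Fin n =>
    ∃ h : (i : ℕ) + 1 < n, σ ⟨(i : ℕ) + 1, h⟩ < σ i).card

/-- The number of inversions of `σ`. -/
def inv {n : ℕ} (σ : Equiv.Perm (Fin n)) : ℕ :=
  (Finset.univ.filter fun q : Fin n × Fin n => q.1 < q.2 ∧ σ q.2 < σ q.1).card

/-- The number of coinversions of `σ`. -/
def coinv {n : ℕ} (σ : Equiv.Perm (Fin n)) : ℕ :=
  (Finset.univ.filter fun q : Fin n × Fin n => q.1 < q.2 ∧ σ q.1 < σ q.2).card

/-- The number of left-to-right minima of `σ`. -/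
def LRmin {n : ℕ} (σ : Equiv.Perm (Fin n)) : ℕ :=
  (Finset.univ.filter fun j : Fin n => ∀ i : Fin n, i < j → σ j < σ i).card

/-- There is a `τ`-match of `σ` starting at (0-based) position `i`, i.e.
`red(σ_i σ_{i+1} ⋯ σ_{i+j-1}) = τ`. -/
def MatchAt {j n : ℕ} (τ : Equiv.Perm (Fin j)) (σ : Equiv.Perm (Fin n)) (i : ℕ) : Prop :=
  ∃ h : i + j ≤ n, ∀ a b : Fin j,
    τ a < τ b ↔
      σ ⟨i + (a : ℕ), by have := a.isLt; omega⟩ < σ ⟨i + (b : ℕ), by have := b.isLt; omega⟩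

/-- The number of `τ`-matches of `σ`. -/
def mch {j n : ℕ} (τ : Equiv.Perm (Fin j)) (σ : Equiv.Perm (Fin n)) : ℕ :=
  ((Finset.range n).filter fun i => MatchAt τ σ i).card

/-- `τ` is minimal overlapping: the smallest `n` such that some `σ ∈ S_n` has
exactly two `τ`-matches is `2j - 1`. -/
def MinOverlapping {j : ℕ} (τ : Equiv.Perm (Fin j)) : Prop :=
  IsLeast {n : ℕ | ∃ σ : Equiv.Perm (Fin n), mch τ σ = 2} (2 * j - 1)

/-- `α` and `β` are mutually minimal overlapping. -/
def MutuallyMinOverlapping {j : ℕ} (α β : Equiv.Perm (Fin j)) : Prop :=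
  MinOverlapping α ∧ MinOverlapping β ∧
    IsLeast {n : ℕ | ∃ σ : Equiv.Perm (Fin n), 1 ≤ mch α σ ∧ 1 ≤ mch β σ} (2 * j - 1)

/-- The set of permutations of `S_n` with no `τ`-match. -/
def NM (n : ℕ) {j : ℕ} (τ : Equiv.Perm (Fin j)) : Finset (Equiv.Perm (Fin n)) :=
  Finset.univ.filter fun σ => mch τ σ = 0

/-- The embedding of `Fin j` onto the window of length `j` of `Fin n` starting at `i`. -/
def window {j n : ℕ} (i : ℕ) (h : i + j ≤ n) : Fin j ↪ Fin n where
  toFun a := ⟨i + (a : ℕ), by have := a.isLt; omega⟩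
  inj' a b hab := by simpa [Fin.ext_iff] using hab

@[simp] lemma window_val {j n : ℕ} (i : ℕ) (h : i + j ≤ n) (a : Fin j) :
    (window i h a : ℕ) = i + a := rfl

@[simp] lemma window_lt_window {j n : ℕ} (i : ℕ) (h : i + j ≤ n) (a b : Fin j) :
    window i h a < window i h b ↔ a < b := by
  rw [Fin.lt_def, Fin.lt_def, window_val, window_val, Nat.add_lt_add_iff_left]

lemma matchAt_iff_window {j n : ℕ} (τ : Equiv.Perm (Fin j)) (σ : Equiv.Perm (Fin n)) (i : ℕ) :
    MatchAt τ σ i ↔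
      ∃ h : i + j ≤ n, ∀ a b, τ a < τ b ↔ σ (window i h a) < σ (window i h b) := Iff.rfl

lemma mem_range_window {j n : ℕ} {i : ℕ} {h : i + j ≤ n} {p : Fin n} :
    p ∈ Set.range (window i h) ↔ i ≤ p ∧ (p : ℕ) < i + j := by
  constructor
  · rintro ⟨a, rfl⟩
    have := a.isLt
    simp
  · rintro ⟨h₁, h₂⟩
    exact ⟨⟨p - i, by omega⟩, Fin.ext (by simp; omega)⟩

/-- Every injective map into a linear order is order isomorphic to a permutation. -/
lemma exists_perm_lt_iff {m : ℕ} {L : Type*} [LinearOrder L] (f : Fin m → L)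
    (hf : Function.Injective f) :
    ∃ ρ : Equiv.Perm (Fin m), ∀ a b, ρ a < ρ b ↔ f a < f b := by
  have hcard : (Finset.univ.image f).card = m := by
    rw [Finset.card_image_of_injective _ hf, Finset.card_fin]
  let e := (Finset.univ.image f).orderIsoOfFin hcard
  let g : Fin m → Fin m := fun a => e.symm ⟨f a, by simp⟩
  have hg : Function.Injective g := fun a b hab => by
    have := e.symm.injective hab
    exact hf (by simpa using this)
  refine ⟨Equiv.ofBijective g (Finite.injective_iff_bijective.mp hg), fun a b => ?_⟩
  simp [g, Equiv.ofBijective_apply]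

/-- Two distinct matches of a minimal overlapping permutation share at most one position. -/
lemma MinOverlapping.le_of_matchAt {j n : ℕ} {τ : Equiv.Perm (Fin j)} (hτ : MinOverlapping τ)
    (σ : Equiv.Perm (Fin n)) {i k : ℕ} (hi : MatchAt τ σ i) (hk : MatchAt τ σ k) (hik : i < k) :
    i + (j - 1) ≤ k := by
  have hex : ∃ k, i < k ∧ MatchAt τ σ k := ⟨k, hik, hk⟩
  obtain ⟨hil, hl⟩ := Nat.find_spec hex
  have hmin : ∀ m, i < m → MatchAt τ σ m → Nat.find hex ≤ m :=
    fun m h₁ h₂ => Nat.find_min' hex ⟨h₁, h₂⟩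
  refine le_trans ?_ (hmin k hik hk)
  generalize Nat.find hex = l at hil hl hmin
  by_contra! hlt
  have hln := hl.1
  obtain ⟨m, hm⟩ : ∃ m, m = l - i + j := ⟨_, rfl⟩
  have hw : i + m ≤ n := by omega
  obtain ⟨ρ, hρ⟩ := exists_perm_lt_iff (fun a => σ (window i hw a))
    (σ.injective.comp (window i hw).injective)
  have key : ∀ t, t + j ≤ m → (MatchAt τ ρ t ↔ MatchAt τ σ (i + t)) := by
    intro t ht
    have hwin : ∀ (h : i + t + j ≤ n) (a : Fin j),
        window i hw (window t ht a) = window (i + t) h a :=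
      fun h a => Fin.ext (by simp [add_assoc])
    rw [matchAt_iff_window, matchAt_iff_window]
    simp only [hρ]
    have h' : i + t + j ≤ n := by omega
    simp only [exists_prop_of_true ht, exists_prop_of_true h', hwin h']
  have hfil : ((Finset.range m).filter fun t => MatchAt τ ρ t) = {0, l - i} := by
    ext t
    simp only [Finset.mem_filter, Finset.mem_range, Finset.mem_insert, Finset.mem_singleton]
    constructor
    · rintro ⟨-, ht⟩
      have htm := ht.1
      by_contra! hne
      have := hmin (i + t) (by omega) ((key t htm).mp ht)
      omega
    · rintro (rfl | rfl)
      · exact ⟨by omega, (key 0 (by omega)).mpr hi⟩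
      · refine ⟨by omega, (key _ (by omega)).mpr ?_⟩
        rwa [Nat.add_sub_cancel' hil.le]
  have hle := hτ.2 ⟨ρ, by rw [mch, hfil, Finset.card_pair (by omega)]⟩
  omega

lemma viaEmbedding_window_val_lt_iff {j n i : ℕ} (h : i + j ≤ n) (ρ : Equiv.Perm (Fin j))
    {p q : Fin n} (hpq : ¬ (p ∈ Set.range (window i h) ∧ q ∈ Set.range (window i h))) :
    ρ.viaEmbedding (window i h) p < ρ.viaEmbedding (window i h) q ↔ p < q := by
  by_cases hp : p ∈ Set.range (window i h) <;> by_cases hq : q ∈ Set.range (window i h)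
  · exact absurd ⟨hp, hq⟩ hpq
  · rw [Equiv.Perm.viaEmbedding_apply_of_notMem _ _ _ hq]
    rw [mem_range_window] at hq
    obtain ⟨a, rfl⟩ := hp
    rw [Equiv.Perm.viaEmbedding_apply, Fin.lt_def, Fin.lt_def, window_val, window_val]
    have := a.isLt; have := (ρ a).isLt
    omega
  · rw [Equiv.Perm.viaEmbedding_apply_of_notMem _ _ _ hp]
    rw [mem_range_window] at hp
    obtain ⟨a, rfl⟩ := hq
    rw [Equiv.Perm.viaEmbedding_apply, Fin.lt_def, Fin.lt_def, window_val, window_val]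
    have := a.isLt; have := (ρ a).isLt
    omega
  · rw [Equiv.Perm.viaEmbedding_apply_of_notMem _ _ _ hp,
      Equiv.Perm.viaEmbedding_apply_of_notMem _ _ _ hq]

lemma viaEmbedding_mem_range {α β : Type*} (ρ : Equiv.Perm α) (ι : α ↪ β) (p : β) :
    ρ.viaEmbedding ι p ∈ Set.range ι ↔ p ∈ Set.range ι := by
  by_cases hp : p ∈ Set.range ι
  · obtain ⟨a, rfl⟩ := hp
    simp [Equiv.Perm.viaEmbedding_apply]
  · rw [Equiv.Perm.viaEmbedding_apply_of_notMem _ _ _ hp]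

/-- The inversions of `σ` inside a `τ`-match are counted by `inv τ`. -/
lemma card_inv_window {j n i : ℕ} (h : i + j ≤ n) {τ : Equiv.Perm (Fin j)}
    {σ : Equiv.Perm (Fin n)}
    (hm : ∀ a b, τ a < τ b ↔ σ (window i h a) < σ (window i h b)) :
    (Finset.univ.filter fun q : Fin n × Fin n => (q.1 < q.2 ∧ σ q.2 < σ q.1) ∧
      (q.1 ∈ Set.range (window i h) ∧ q.2 ∈ Set.range (window i h))).card = inv τ := by
  symm
  refine Finset.card_bij (fun q _ => (window i h q.1, window i h q.2)) ?_ ?_ ?_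
  · rintro ⟨a, b⟩ hab
    simp_all
  · rintro ⟨a, b⟩ - ⟨c, d⟩ - hq
    simpa using hq
  · rintro ⟨p, q⟩ hq
    simp only [Finset.mem_filter, Finset.mem_univ, true_and] at hq
    obtain ⟨⟨h₁, h₂⟩, ⟨a, rfl⟩, ⟨b, rfl⟩⟩ := hq
    refine ⟨(a, b), ?_, rfl⟩
    rw [← hm] at h₂
    rw [window_lt_window] at h₁
    exact Finset.mem_filter.mpr ⟨Finset.mem_univ _, h₁, h₂⟩

lemma matchAt_mul_viaEmbedding {j n i : ℕ} (h : i + j ≤ n) (α β : Equiv.Perm (Fin j))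
    (σ : Equiv.Perm (Fin n)) :
    MatchAt β (σ * (α⁻¹ * β).viaEmbedding (window i h)) i ↔ MatchAt α σ i := by
  rw [matchAt_iff_window, matchAt_iff_window]
  simp only [exists_prop_of_true h, Equiv.Perm.mul_apply, Equiv.Perm.viaEmbedding_apply]
  constructor
  · intro H a b
    simpa using H (β⁻¹ (α a)) (β⁻¹ (α b))
  · intro H a b
    simpa using H (α⁻¹ (β a)) (α⁻¹ (β b))

/-- Rearranging an `α`-match into a `β`-match preserves the inversion number if
`inv α = inv β`. -/
lemma inv_mul_viaEmbedding {j n i : ℕ} (h : i + j ≤ n) {α β : Equiv.Perm (Fin j)}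
    (hinv : inv α = inv β) {σ : Equiv.Perm (Fin n)} (hσ : MatchAt α σ i) :
    inv (σ * (α⁻¹ * β).viaEmbedding (window i h)) = inv σ := by
  have hσ' := (matchAt_mul_viaEmbedding h α β σ).mpr hσ
  set π := (α⁻¹ * β).viaEmbedding (window i h) with hπ
  rw [inv, inv, ← Finset.card_filter_add_card_filter_not (fun q : Fin n × Fin n =>
      q.1 ∈ Set.range (window i h) ∧ q.2 ∈ Set.range (window i h)),
    ← Finset.card_filter_add_card_filter_not (s := Finset.univ.filter _)
      (fun q : Fin n × Fin n => q.1 ∈ Set.range (window i h) ∧ q.2 ∈ Set.range (window i h))]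
  simp only [Finset.filter_filter]
  rw [card_inv_window h hσ.2, card_inv_window h hσ'.2, hinv]
  congr 1
  refine Finset.card_equiv (π.prodCongr π) fun q => ?_
  rw [Finset.mem_filter, Finset.mem_filter]
  simp only [Finset.mem_univ, true_and, Equiv.prodCongr_apply, Prod.map_fst,
    Prod.map_snd, Equiv.Perm.mul_apply]
  rw [hπ, viaEmbedding_mem_range, viaEmbedding_mem_range, ← hπ]
  refine and_congr_left fun hq => and_congr_left fun _ => ?_
  rw [hπ, viaEmbedding_window_val_lt_iff h _ hq]

/-- Rearranging a window while fixing its endpoints does not affect a match that shares at most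
an endpoint with it. -/
lemma matchAt_mul_viaEmbedding_of_far {j n i k : ℕ} (hj : 0 < j) (h : i + j ≤ n)
    {ρ : Equiv.Perm (Fin j)} (h₀ : ρ ⟨0, hj⟩ = ⟨0, hj⟩)
    (h₁ : ρ ⟨j - 1, by omega⟩ = ⟨j - 1, by omega⟩)
    (hik : i + (j - 1) ≤ k ∨ k + (j - 1) ≤ i) (τ : Equiv.Perm (Fin j)) (σ : Equiv.Perm (Fin n)) :
    MatchAt τ (σ * ρ.viaEmbedding (window i h)) k ↔ MatchAt τ σ k := by
  have hfix : ∀ (hk : k + j ≤ n) (a : Fin j),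
      ρ.viaEmbedding (window i h) (window k hk a) = window k hk a := by
    intro hk a
    by_cases ha : window k hk a ∈ Set.range (window i h)
    · obtain ⟨b, hb⟩ := ha
      have hb' := congrArg Fin.val hb
      simp only [window_val] at hb'
      rw [← hb, Equiv.Perm.viaEmbedding_apply]
      congr 1
      have := a.isLt; have := b.isLt
      rcases hik with hik | hik
      · have hbj : b = ⟨j - 1, by omega⟩ := Fin.ext (by simp only; omega)
        rw [hbj, h₁]
      · have hb₀ : b = ⟨0, hj⟩ := Fin.ext (by simp only; omega)
        rw [hb₀, h₀]
    · exact Equiv.Perm.viaEmbedding_apply_of_notMem _ _ _ ha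
  simp only [matchAt_iff_window, Equiv.Perm.mul_apply, hfix]

lemma MinOverlapping.far {j n : ℕ} {τ : Equiv.Perm (Fin j)} (hτ : MinOverlapping τ)
    {σ : Equiv.Perm (Fin n)} {i k : ℕ} (hi : MatchAt τ σ i) (hk : MatchAt τ σ k) (hik : i ≠ k) :
    i + (j - 1) ≤ k ∨ k + (j - 1) ≤ i := by
  rcases hik.lt_or_gt with h | h
  · exact Or.inl (hτ.le_of_matchAt σ hi hk h)
  · exact Or.inr (hτ.le_of_matchAt σ hk hi h)

/-- The inversion enumerators of the permutations with prescribed matches at a set of positions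
agree for `α` and `β`. -/
lemma sum_pow_inv_matchAt_eq {R : Type*} [CommRing R] {j : ℕ} (hj : 0 < j)
    {α β : Equiv.Perm (Fin j)} (hα : MinOverlapping α) (hβ : MinOverlapping β)
    (hfirst : α ⟨0, hj⟩ = β ⟨0, hj⟩)
    (hlast : α ⟨j - 1, by omega⟩ = β ⟨j - 1, by omega⟩)
    (hinv : inv α = inv β) (y : R) (n : ℕ) (U : Finset ℕ) :
    ∑ σ : Equiv.Perm (Fin n) with ∀ i ∈ U, MatchAt α σ i, y ^ inv σ =
      ∑ σ : Equiv.Perm (Fin n) with ∀ i ∈ U, MatchAt β σ i, y ^ inv σ := by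
  by_cases hU : (∀ i ∈ U, i + j ≤ n) ∧
      ∀ i ∈ U, ∀ k ∈ U, i ≠ k → i + (j - 1) ≤ k ∨ k + (j - 1) ≤ i
  · obtain ⟨hn, hfar⟩ := hU
    have step : ∀ S ⊆ U,
        ∑ σ : Equiv.Perm (Fin n) with ∀ i ∈ U, MatchAt α σ i, y ^ inv σ =
          ∑ σ : Equiv.Perm (Fin n) with ∀ i ∈ U, MatchAt (if i ∈ S then β else α) σ i,
            y ^ inv σ := by
      intro S
      induction S using Finset.induction_on with
      | empty => simp
      | insert i S hiS ih =>
        intro hS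
        have hi : i ∈ U := hS (Finset.mem_insert_self i S)
        rw [ih ((Finset.subset_insert i S).trans hS)]
        refine Finset.sum_equiv
          (Equiv.mulRight ((α⁻¹ * β).viaEmbedding (window i (hn i hi)))) ?_ ?_
        · intro σ
          simp only [Finset.mem_filter, Finset.mem_univ, true_and, Equiv.coe_mulRight]
          refine forall₂_congr fun k hk => ?_
          by_cases hki : k = i
          · subst hki
            rw [if_neg hiS, if_pos (Finset.mem_insert_self k S), matchAt_mul_viaEmbedding]
          · rw [matchAt_mul_viaEmbedding_of_far hj (hn i hi) _ _ (hfar i hi k hk (Ne.symm hki))]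
            · simp [hki]
            · simp [← hfirst]
            · simp [← hlast]
        · intro σ hσ
          simp only [Finset.mem_filter, Finset.mem_univ, true_and] at hσ
          have hσi := hσ i hi
          rw [if_neg hiS] at hσi
          rw [Equiv.coe_mulRight, inv_mul_viaEmbedding (hn i hi) hinv hσi]
    rw [step U subset_rfl]
    refine Finset.sum_congr (Finset.filter_congr fun σ _ => forall₂_congr fun i hi => ?_)
      fun _ _ => rfl
    rw [if_pos hi]
  · have hempty : ∀ τ : Equiv.Perm (Fin j), MinOverlapping τ →
        (Finset.univ.filter fun σ : Equiv.Perm (Fin n) => ∀ i ∈ U, MatchAt τ σ i) = ∅ := by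
      intro τ hτ
      refine Finset.filter_eq_empty_iff.mpr fun σ _ hσ => hU ⟨fun i hi => (hσ i hi).1, ?_⟩
      exact fun i hi k hk hik => hτ.far (hσ i hi) (hσ k hk) hik
    rw [hempty α hα, hempty β hβ]

/-- Expansion of the joint enumerator of `mch τ` and `inv` over sets of marked matches. -/
lemma sum_pow_mch_mul_pow_inv {R : Type*} [CommRing R] {j : ℕ} (τ : Equiv.Perm (Fin j))
    (x y : R) (n : ℕ) :
    ∑ σ : Equiv.Perm (Fin n), x ^ mch τ σ * y ^ inv σ =
      ∑ U ∈ (Finset.range n).powerset, (x - 1) ^ U.card *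
        ∑ σ : Equiv.Perm (Fin n) with ∀ i ∈ U, MatchAt τ σ i, y ^ inv σ := by
  have hpow : ∀ σ : Equiv.Perm (Fin n), x ^ mch τ σ =
      ∑ U ∈ (Finset.range n).powerset with ∀ i ∈ U, MatchAt τ σ i, (x - 1) ^ U.card := by
    intro σ
    have hset : ((Finset.range n).powerset.filter fun U => ∀ i ∈ U, MatchAt τ σ i) =
        ((Finset.range n).filter fun i => MatchAt τ σ i).powerset := by
      ext U
      simp [Finset.subset_iff, forall_and]
    have := Finset.sum_pow_mul_eq_add_pow (x - 1) 1
      ((Finset.range n).filter fun i => MatchAt τ σ i)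
    rw [hset, mch]
    simpa using this.symm
  simp only [hpow, Finset.sum_mul, Finset.mul_sum, Finset.sum_filter, ite_mul, mul_ite, zero_mul,
    mul_zero]
  exact Finset.sum_comm

/-- Theorem: if `α, β ∈ S_j` (`j ≥ 3`) are minimal overlapping with `α_1 = β_1`,
`α_j = β_j` and `inv α = inv β`, then for all `n ≥ 0`,
`Σ_{σ∈S_n} x^{α-mch σ} q^{inv σ} = Σ_{σ∈S_n} x^{β-mch σ} q^{inv σ}` as polynomials in
`x` (= `X 0`) and `q` (= `X 1`), i.e. `α` and `β` are strongly inv-c-Wilf equivalent. -/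
theorem stmt6 {j : ℕ} (hj : 3 ≤ j) (α β : Equiv.Perm (Fin j))
    (hα : MinOverlapping α) (hβ : MinOverlapping β)
    (hfirst : α ⟨0, by omega⟩ = β ⟨0, by omega⟩)
    (hlast : α ⟨j - 1, by omega⟩ = β ⟨j - 1, by omega⟩)
    (hinv : inv α = inv β) :
    ∀ n : ℕ,
      (∑ σ : Equiv.Perm (Fin n),
        (MvPolynomial.X 0 : MvPolynomial (Fin 2) ℚ) ^ mch α σ * MvPolynomial.X 1 ^ inv σ) =
      ∑ σ : Equiv.Perm (Fin n),
        (MvPolynomial.X 0 : MvPolynomial (Fin 2) ℚ) ^ mch β σ * MvPolynomial.X 1 ^ inv σ := by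
  intro n
  rw [sum_pow_mch_mul_pow_inv, sum_pow_mch_mul_pow_inv]
  refine Finset.sum_congr rfl fun U _ => ?_
  rw [sum_pow_inv_matchAt_eq (by omega) hα hβ hfirst hlast hinv]

end CWilf
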